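/- Let μ > 0 and let W_vol : (0,∞) → ℝ be a C² function with W_vol(t) = 0 if and only if t = 1, W_vol(t) → +∞ as t → 0⁺, W_vol(t) ≥ k t² for all t ≥ M for some constants M, k > 0, and W_vol''(1) > 0. For ε > 0 and F ∈ ℝ^{3×3} with det F > 0, define W_ε(F) := min_{n ∈ S²} (μ/2)(tr(Fᵀ L_{n,ε}^{−1} F)/(det F)^{2/3} − 3) + W_vol(det F), where L_{n,ε} := (1+ε)² n⊗n + (1+ε)^{−1}(I − n⊗n), and let 𝓤_ε := { R L_{n,ε}^{1/2} : n ∈ S², R ∈ SO(3) } with L_{n,ε}^{1/2} := (1+ε) n⊗n + (1+ε)^{−1/2}(I − n⊗n). Then there exist constants c > 0 and R₀ > 0 such that for every ε ∈ (0,1] and every F ∈ ℝ^{3×3} with det F > 0 and ‖F‖ ≥ R₀, one has W_ε(F) ≥ c·dist^{3/2}(F, 𝓤_ε). -/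

import Mathlib

open Matrix Filter Topology

noncomputable section

/-- Frobenius norm of a real `3 × 3` matrix. -/
def frob (F : Matrix (Fin 3) (Fin 3) ℝ) : ℝ :=
  Real.sqrt (∑ i, ∑ j, (F i j) ^ 2)

/-- Distance (w.r.t. the Frobenius norm) from a matrix to a set of matrices. -/
def fdist (F : Matrix (Fin 3) (Fin 3) ℝ) (S : Set (Matrix (Fin 3) (Fin 3) ℝ)) : ℝ :=
  sInf ((fun G => frob (F - G)) '' S)

/-- The special orthogonal group `SO(3)` as a set of matrices. -/
def SO3 : Set (Matrix (Fin 3) (Fin 3) ℝ) :=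
  {R | R * Rᵀ = 1 ∧ R.det = 1}

/-- The unit sphere `S²` as a subtype of `ℝ³`. -/
def Sph : Type := {n : Fin 3 → ℝ // ∑ i, (n i) ^ 2 = 1}

/-- `L_{n,ε} = (1+ε)² n⊗n + (1+ε)⁻¹ (I - n⊗n)`. -/
def Lne (ε : ℝ) (n : Fin 3 → ℝ) : Matrix (Fin 3) (Fin 3) ℝ :=
  (1 + ε) ^ 2 • Matrix.vecMulVec n n + (1 + ε)⁻¹ • (1 - Matrix.vecMulVec n n)

/-- `L_{n,ε}^{1/2} = (1+ε) n⊗n + (1+ε)^{-1/2} (I - n⊗n)`. -/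
def LneHalf (ε : ℝ) (n : Fin 3 → ℝ) : Matrix (Fin 3) (Fin 3) ℝ :=
  (1 + ε) • Matrix.vecMulVec n n + ((1 + ε) ^ (-(1 : ℝ) / 2)) • (1 - Matrix.vecMulVec n n)

/-- The conditions on the volumetric energy `W_vol`. -/
structure WvolHyp (Wvol : ℝ → ℝ) : Prop where
  c2 : ContDiffOn ℝ 2 Wvol (Set.Ioi (0 : ℝ))
  zero_iff : ∀ t : ℝ, 0 < t → (Wvol t = 0 ↔ t = 1)
  tendsto_top : Tendsto Wvol (𝓝[>] (0 : ℝ)) atTop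
  quad_growth : ∃ M > (0 : ℝ), ∃ k > (0 : ℝ), ∀ t : ℝ, M ≤ t → k * t ^ 2 ≤ Wvol t
  second_deriv_pos : 0 < deriv (deriv Wvol) 1

/-- The small-strain nematic energy
`W_ε(F) = min_{n∈S²} (μ/2)(tr(Fᵀ L_{n,ε}⁻¹ F)/(det F)^{2/3} − 3) + W_vol(det F)`. -/
def Weps (μ : ℝ) (Wvol : ℝ → ℝ) (ε : ℝ) (F : Matrix (Fin 3) (Fin 3) ℝ) : ℝ :=
  ⨅ n : Sph, (μ / 2 * (Matrix.trace (Fᵀ * (Lne ε n.1)⁻¹ * F) / F.det ^ ((2 : ℝ) / 3) - 3)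
    + Wvol F.det)

/-- The wells `𝓤_ε = { R L_{n,ε}^{1/2} : n ∈ S², R ∈ SO(3) }`. -/
def Ueps (ε : ℝ) : Set (Matrix (Fin 3) (Fin 3) ℝ) :=
  {G | ∃ n : Fin 3 → ℝ, (∑ i, (n i) ^ 2 = 1) ∧ ∃ R ∈ SO3, G = R * LneHalf ε n}

lemma frob_nonneg (F : Matrix (Fin 3) (Fin 3) ℝ) : 0 ≤ frob F :=
  Real.sqrt_nonneg _

lemma frob_sq (F : Matrix (Fin 3) (Fin 3) ℝ) : frob F ^ 2 = ∑ i, ∑ j, (F i j) ^ 2 :=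
  Real.sq_sqrt (Finset.sum_nonneg fun _ _ => Finset.sum_nonneg fun _ _ => sq_nonneg _)

lemma WvolHyp.nonneg {Wvol : ℝ → ℝ} (hW : WvolHyp Wvol) {t : ℝ} (ht : 0 < t) : 0 ≤ Wvol t := by
  by_contra! hneg
  have hcont := hW.c2.continuousOn
  have ht1 : t ≠ 1 := fun h => hneg.ne ((hW.zero_iff t ht).2 h)
  rcases lt_or_gt_of_ne ht1 with h | h
  · obtain ⟨s, hs, hs0, hst⟩ := ((hW.tendsto_top.eventually_gt_atTop 0).and
      (Ioo_mem_nhdsGT ht)).exists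
    obtain ⟨z, hz, hz0⟩ := intermediate_value_Icc' hst.le
      (hcont.mono fun z hz => lt_of_lt_of_le hs0 hz.1) ⟨hneg.le, hs.le⟩
    have := (hW.zero_iff z (hs0.trans_le hz.1)).1 hz0
    linarith [hz.2]
  · obtain ⟨M, hM, k, hk, hgrow⟩ := hW.quad_growth
    have hs : 0 < Wvol (max M t) :=
      lt_of_lt_of_le (by positivity) (hgrow _ (le_max_left M t))
    obtain ⟨z, hz, hz0⟩ := intermediate_value_Icc (le_max_right M t)
      (hcont.mono fun z hz => lt_of_lt_of_le ht hz.1) ⟨hneg.le, hs.le⟩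
    have := (hW.zero_iff z (ht.trans_le hz.1)).1 hz0
    linarith [hz.1]

lemma Lne_inv {ε : ℝ} (hε : 0 < ε) {n : Fin 3 → ℝ} (hn : ∑ i, (n i) ^ 2 = 1) :
    (Lne ε n)⁻¹ = ((1 + ε) ^ 2)⁻¹ • Matrix.vecMulVec n n
      + (1 + ε) • (1 - Matrix.vecMulVec n n) := by
  have hP : Matrix.vecMulVec n n * Matrix.vecMulVec n n = Matrix.vecMulVec n n := by
    have hdot : n ⬝ᵥ n = 1 := by simpa [dotProduct, sq] using hn
    rw [Matrix.vecMulVec_mul_vecMulVec, hdot]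
    simp
  have h1 : (1 + ε) ≠ 0 := by positivity
  apply Matrix.inv_eq_right_inv
  simp only [Lne, add_mul, mul_add, smul_mul_assoc, mul_smul_comm, mul_sub, sub_mul, hP,
    mul_one, one_mul, sub_self, smul_zero, add_zero, smul_smul]
  rw [inv_mul_cancel₀ (pow_ne_zero 2 h1), add_sub_cancel_left, smul_smul, mul_inv_cancel₀ h1,
    one_smul, one_smul, add_sub_cancel]

lemma frob_sq_div_four_le_trace {ε : ℝ} (hε : 0 < ε) (hε1 : ε ≤ 1) {n : Fin 3 → ℝ}
    (hn : ∑ i, (n i) ^ 2 = 1) (F : Matrix (Fin 3) (Fin 3) ℝ) :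
    frob F ^ 2 / 4 ≤ Matrix.trace (Fᵀ * (Lne ε n)⁻¹ * F) := by
  have hQ : Matrix.trace (Fᵀ * Matrix.vecMulVec n n * F) = ∑ j, (∑ i, n i * F i j) ^ 2 := by
    simp [Matrix.trace, Matrix.mul_apply, Matrix.vecMulVec_apply, Fin.sum_univ_three]
    ring
  have hT : Matrix.trace (Fᵀ * F) = frob F ^ 2 := by
    rw [frob_sq, Finset.sum_comm]
    simp [Matrix.trace, Matrix.mul_apply, sq]
  have hle : ∑ j, (∑ i, n i * F i j) ^ 2 ≤ frob F ^ 2 := by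
    rw [frob_sq, Finset.sum_comm]
    refine Finset.sum_le_sum fun j _ => ?_
    simpa [hn] using Finset.sum_mul_sq_le_sq_mul_sq Finset.univ n (fun i => F i j)
  have hQ0 : 0 ≤ ∑ j, (∑ i, n i * F i j) ^ 2 := Finset.sum_nonneg fun _ _ => sq_nonneg _
  have htr : Matrix.trace (Fᵀ * (Lne ε n)⁻¹ * F) =
      ((1 + ε) ^ 2)⁻¹ * ∑ j, (∑ i, n i * F i j) ^ 2
        + (1 + ε) * (frob F ^ 2 - ∑ j, (∑ i, n i * F i j) ^ 2) := by
    rw [Lne_inv hε hn, ← hQ, ← hT]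
    simp only [mul_add, add_mul, mul_sub, sub_mul, mul_smul_comm, smul_mul_assoc, mul_one,
      Matrix.trace_add, Matrix.trace_sub, Matrix.trace_smul, smul_eq_mul, smul_sub]
  have ha : (1 / 4 : ℝ) ≤ ((1 + ε) ^ 2)⁻¹ := by
    rw [← one_div]
    exact one_div_le_one_div_of_le (by positivity) (by nlinarith)
  rw [htr]
  nlinarith [mul_le_mul_of_nonneg_right ha hQ0,
    mul_nonneg (show 0 ≤ 3 / 4 + ε by positivity) (sub_nonneg.2 hle)]

lemma fdist_Ueps_nonneg (ε : ℝ) (F : Matrix (Fin 3) (Fin 3) ℝ) : 0 ≤ fdist F (Ueps ε) := by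
  apply Real.sInf_nonneg
  rintro _ ⟨G, -, rfl⟩
  exact frob_nonneg _

lemma fdist_Ueps_le {ε : ℝ} (hε : 0 < ε) (hε1 : ε ≤ 1) {F : Matrix (Fin 3) (Fin 3) ℝ}
    (hF : 3 ≤ frob F) : fdist F (Ueps ε) ≤ 2 * frob F := by
  set n : Fin 3 → ℝ := ![1, 0, 0] with hn
  have hmem : LneHalf ε n ∈ Ueps ε :=
    ⟨n, by simp [hn, Fin.sum_univ_three], 1, by simp [SO3], by simp⟩
  have hbdd : BddBelow ((fun G => frob (F - G)) '' Ueps ε) :=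
    ⟨0, by rintro _ ⟨G, -, rfl⟩; exact frob_nonneg _⟩
  refine (csInf_le hbdd ⟨_, hmem, rfl⟩).trans ?_
  refine (le_abs_self _).trans
    (abs_le_of_sq_le_sq ?_ (mul_nonneg zero_le_two (frob_nonneg F)))
  have hG : frob (LneHalf ε n) ^ 2 ≤ 6 := by
    have hb : (1 + ε) ^ (-(1 : ℝ) / 2) ≤ 1 :=
      Real.rpow_le_one_of_one_le_of_nonpos (by linarith) (by norm_num)
    have hb0 : 0 ≤ (1 + ε) ^ (-(1 : ℝ) / 2) := by positivity
    have : frob (LneHalf ε n) ^ 2 = (1 + ε) ^ 2 + 2 * ((1 + ε) ^ (-(1 : ℝ) / 2)) ^ 2 := by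
      rw [frob_sq]
      simp [LneHalf, hn, Fin.sum_univ_three]
      ring
    rw [this]
    nlinarith
  have hsub : frob (F - LneHalf ε n) ^ 2 ≤ 2 * frob F ^ 2 + 2 * frob (LneHalf ε n) ^ 2 := by
    simp only [frob_sq, Finset.mul_sum, ← Finset.sum_add_distrib]
    refine Finset.sum_le_sum fun i _ => Finset.sum_le_sum fun j _ => ?_
    rw [Matrix.sub_apply]
    nlinarith [sq_nonneg (F i j + LneHalf ε n i j)]
  nlinarith

instance : Nonempty Sph := ⟨⟨![1, 0, 0], by simp [Fin.sum_univ_three]⟩⟩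

lemma sqrt_pow_three_le_energy_density {μ k d x T w M : ℝ} (hμ : 0 < μ) (hk : 0 < k)
    (hd : 0 < d) (hx : 24 + M ^ 2 + 3 * μ / k ≤ x) (hT : x ^ 2 / 4 ≤ T) (hw : 0 ≤ w)
    (hgrow : M ≤ d → k * d ^ 2 ≤ w) :
    min (μ / 16) (k / 2) * √x ^ 3 ≤ μ / 2 * (T / d ^ ((2 : ℝ) / 3) - 3) + w := by
  have hμk : 0 < 3 * μ / k := by positivity
  have hx1 : 1 ≤ x := by nlinarith
  set r := √x with hr
  have hr1 : 1 ≤ r := by rw [hr]; exact Real.one_le_sqrt.2 hx1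
  have hrx : r ^ 2 = x := Real.sq_sqrt (by linarith)
  have hxr : x ≤ r ^ 3 := by nlinarith
  set s := d ^ ((2 : ℝ) / 3) with hs
  have hs0 : 0 < s := Real.rpow_pos_of_pos hd _
  have hs3 : s ^ 3 = d ^ 2 := by
    rw [hs, ← Real.rpow_natCast, ← Real.rpow_mul hd.le, ← Real.rpow_natCast]
    norm_num
  have hr3 : 0 ≤ r ^ 3 := by positivity
  rcases le_or_gt s r with h | h
  · have hTs : r ^ 3 / 4 ≤ T / s := by
      rw [le_div_iff₀ hs0]
      have : r ^ 3 * s ≤ r ^ 3 * r := mul_le_mul_of_nonneg_left h hr3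
      rw [← hrx] at hT
      nlinarith
    have h24 : 24 ≤ r ^ 3 := by nlinarith
    have hmin := mul_le_mul_of_nonneg_right (min_le_left (μ / 16) (k / 2)) hr3
    have hmul := mul_le_mul_of_nonneg_left hTs hμ.le
    have hmul' := mul_le_mul_of_nonneg_left h24 hμ.le
    linarith
  · have hrd : r ^ 3 ≤ d ^ 2 := by
      rw [← hs3]
      exact pow_le_pow_left₀ (by linarith) h.le 3
    have hMd : M ≤ d := (le_abs_self _).trans (abs_le_of_sq_le_sq (by linarith) hd.le)
    have hw' := hgrow hMd
    have hT0 : 0 ≤ T / s := div_nonneg (le_trans (by positivity) hT) hs0.le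
    have hmin := mul_le_mul_of_nonneg_right (min_le_right (μ / 16) (k / 2)) hr3
    have hkr : 3 * μ ≤ k * r ^ 3 := by
      have : 3 * μ / k ≤ r ^ 3 := by nlinarith
      rwa [div_le_iff₀ hk, mul_comm (r ^ 3)] at this
    have hkd := mul_le_mul_of_nonneg_left hrd hk.le
    have hμT := mul_nonneg hμ.le hT0
    linarith

/-- there exist `c > 0` and `R₀ > 0` such that for every `ε ∈ (0,1]` and
every `F` with `det F > 0` and `‖F‖ ≥ R₀`, one has `W_ε(F) ≥ c dist^{3/2}(F, 𝓤_ε)`. -/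
theorem Weps_lower_bound_far (μ : ℝ) (hμ : 0 < μ) (Wvol : ℝ → ℝ) (hW : WvolHyp Wvol) :
    ∃ c > (0 : ℝ), ∃ R₀ > (0 : ℝ), ∀ ε : ℝ, 0 < ε → ε ≤ 1 →
      ∀ F : Matrix (Fin 3) (Fin 3) ℝ, 0 < F.det → R₀ ≤ frob F →
        c * (fdist F (Ueps ε)) ^ ((3 : ℝ) / 2) ≤ Weps μ Wvol ε F := by
  obtain ⟨M, hM, k, hk, hgrow⟩ := hW.quad_growth
  have hm : 0 < min (μ / 16) (k / 2) := lt_min (by positivity) (by positivity)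
  refine ⟨min (μ / 16) (k / 2) / 8, by positivity, 24 + M ^ 2 + 3 * μ / k, by positivity, ?_⟩
  intro ε hε hε1 F hF hFR
  have hμk : 0 < 3 * μ / k := by positivity
  have hF3 : 3 ≤ frob F := by nlinarith
  have hdist : fdist F (Ueps ε) ^ ((3 : ℝ) / 2) ≤ 8 * √(frob F) ^ 3 := by
    calc fdist F (Ueps ε) ^ ((3 : ℝ) / 2)
        ≤ ((2 * √(frob F)) ^ 2) ^ ((3 : ℝ) / 2) := by
          refine Real.rpow_le_rpow (fdist_Ueps_nonneg ε F) ?_ (by norm_num)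
          rw [mul_pow, Real.sq_sqrt (frob_nonneg F)]
          linarith [fdist_Ueps_le hε hε1 hF3]
      _ = 8 * √(frob F) ^ 3 := by
          rw [← Real.rpow_natCast, ← Real.rpow_mul (by positivity)]
          norm_num [mul_pow]
  refine le_ciInf fun n => ?_
  refine le_trans ?_ (sqrt_pow_three_le_energy_density hμ hk hF hFR
    (frob_sq_div_four_le_trace hε hε1 n.2 F) (hW.nonneg hF) (hgrow F.det))
  nlinarith [mul_le_mul_of_nonneg_left hdist hm.le]
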